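/- arXiv:2008.04790 — 2 statements merged into one kernel-verified Lean document; each statement's English description precedes it below -/
import Mathlib

section
/- Consider the homogeneous stochastic block model with N nodes, K ≥ 2 blocks and strictly positive probability mass functions f, g on a finite set S, where the node labelling σ is uniformly distributed on {1,…,K}^N and, given σ, the data x has law P_σ. Let I = D_{1/2}(f‖g), Z = ∑_{x∈S} √(f(x) g(x)), h = Z^{-1} √(f g), J = ∑_{x∈S} h(x) log²(f(x)/g(x)), and I_21 = (1/2 − 1/K) K^{-1} I² + (1/2) K^{-1} J. Assume N ≥ 8 K log(4K²). Then for every estimator σ̂ from the data space to {1,…,K}^N, E[ Ham*(σ, σ̂(x)) / N ] ≥ (1/84) K^{-3} exp(−(N/K) I − √(8 N I_21)) − (1/6) exp(−N/(8K)). -/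
open Finset

/-- Hamming distance between two node labellings. -/
def ham {N K : ℕ} (σ₁ σ₂ : Fin N → Fin K) : ℕ :=
  (Finset.univ.filter fun i => σ₁ i ≠ σ₂ i).card

/-- Absolute classification error: minimum Hamming distance over relabellings of `σ₂`. -/
def hamStar {N K : ℕ} (σ₁ σ₂ : Fin N → Fin K) : ℕ :=
  Finset.univ.inf' Finset.univ_nonempty fun ρ : Equiv.Perm (Fin K) =>
    ham σ₁ (fun i => ρ (σ₂ i))

/-- Index type for unordered pairs of distinct nodes, represented by ordered pairs `i < j`. -/
abbrev PairIdx (N : ℕ) := {p : Fin N × Fin N // p.1 < p.2}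

/-- Probability assigned by the homogeneous SBM with labelling `σ`, intra-block interaction
distribution `f` and inter-block interaction distribution `g`, to the data array `x`. -/
noncomputable def sbmProb {N K : ℕ} {S : Type*} [Fintype S] (f g : S → ℝ)
    (σ : Fin N → Fin K) (x : PairIdx N → S) : ℝ :=
  ∏ p : PairIdx N, (if σ p.1.1 = σ p.1.2 then f (x p) else g (x p))

/-- The total mass of a product of probability mass functions is one. -/
theorem sum_prod_pmf {ι S : Type*} [Fintype ι] [DecidableEq ι] [Fintype S] (r : ι → S → ℝ)
    (hr : ∀ e, ∑ s, r e s = 1) : ∑ x : ι → S, ∏ e, r e (x e) = 1 := by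
  rw [← Fintype.prod_sum]
  simp [hr]

/-- Expectation of a function of one coordinate under a product distribution. -/
theorem sum_prod_pmf_mul {ι S : Type*} [Fintype ι] [DecidableEq ι] [Fintype S] (r : ι → S → ℝ)
    (hr : ∀ e, ∑ s, r e s = 1) (a : ι) (u : S → ℝ) :
    ∑ x : ι → S, (∏ e, r e (x e)) * u (x a) = ∑ s, r a s * u s := by
  have h1 : ∀ x : ι → S, (∏ e, r e (x e)) * u (x a)
      = ∏ e, (r e (x e) * if e = a then u (x e) else 1) := by
    intro x
    rw [Finset.prod_mul_distrib]
    simp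
  simp_rw [h1]
  rw [← Fintype.prod_sum fun e s => r e s * if e = a then u s else 1,
    Finset.prod_eq_single a]
  · simp
  · intro b _ hb
    simp [hb, hr]
  · simp

/-- Expectation of a product of functions of two distinct coordinates under a product
distribution. -/
theorem sum_prod_pmf_mul_mul {ι S : Type*} [Fintype ι] [DecidableEq ι] [Fintype S]
    (r : ι → S → ℝ) (hr : ∀ e, ∑ s, r e s = 1) {a b : ι} (hab : a ≠ b) (u v : S → ℝ) :
    ∑ x : ι → S, (∏ e, r e (x e)) * (u (x a) * v (x b))
      = (∑ s, r a s * u s) * ∑ s, r b s * v s := by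
  have h1 : ∀ x : ι → S, (∏ e, r e (x e)) * (u (x a) * v (x b))
      = ∏ e, (r e (x e) * ((if e = a then u (x e) else 1) * if e = b then v (x e) else 1)) := by
    intro x
    rw [Finset.prod_mul_distrib, Finset.prod_mul_distrib]
    simp
  simp_rw [h1]
  rw [← Fintype.prod_sum
      fun e s => r e s * ((if e = a then u s else 1) * if e = b then v s else 1),
    Finset.prod_eq_mul a b hab]
  · simp [hab, hab.symm]
  · rintro c _ ⟨hca, hcb⟩
    simp [hca, hcb, hr]
  · simp
  · simp

/-- First moment of a sum of functions of the coordinates under a product distribution. -/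
theorem sum_prod_pmf_mul_sum {ι S : Type*} [Fintype ι] [DecidableEq ι] [Fintype S]
    (r : ι → S → ℝ) (hr : ∀ e, ∑ s, r e s = 1) (u : ι → S → ℝ) :
    ∑ x : ι → S, (∏ e, r e (x e)) * ∑ e, u e (x e) = ∑ e, ∑ s, r e s * u e s := by
  simp_rw [Finset.mul_sum]
  rw [Finset.sum_comm]
  exact Finset.sum_congr rfl fun a _ => sum_prod_pmf_mul r hr a (u a)

/-- Second moment of a sum of functions of the coordinates under a product distribution. -/
theorem sum_prod_pmf_mul_sum_sq {ι S : Type*} [Fintype ι] [DecidableEq ι] [Fintype S]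
    (r : ι → S → ℝ) (hr : ∀ e, ∑ s, r e s = 1) (u : ι → S → ℝ) :
    ∑ x : ι → S, (∏ e, r e (x e)) * (∑ e, u e (x e)) ^ 2
      = ∑ e, (∑ s, r e s * u e s ^ 2 - (∑ s, r e s * u e s) ^ 2)
        + (∑ e, ∑ s, r e s * u e s) ^ 2 := by
  have h1 : ∀ a b : ι, ∑ x : ι → S, (∏ e, r e (x e)) * (u a (x a) * u b (x b))
      = (∑ s, r a s * u a s) * (∑ s, r b s * u b s)
        + if a = b then (∑ s, r a s * u a s ^ 2 - (∑ s, r a s * u a s) ^ 2) else 0 := by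
    intro a b
    split_ifs with hab
    · subst hab
      rw [sum_prod_pmf_mul r hr a fun s => u a s * u a s]
      simp_rw [← sq]
      ring
    · rw [sum_prod_pmf_mul_mul r hr hab, add_zero]
  have h2 : ∀ x : ι → S, (∏ e, r e (x e)) * (∑ e, u e (x e)) ^ 2
      = ∑ a, ∑ b, (∏ e, r e (x e)) * (u a (x a) * u b (x b)) := by
    intro x
    rw [sq, Finset.sum_mul_sum, Finset.mul_sum]
    simp_rw [Finset.mul_sum]
  simp_rw [h2]
  rw [Finset.sum_comm]
  simp_rw [Finset.sum_comm (s := (Finset.univ : Finset (ι → S))), h1,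
    Finset.sum_add_distrib]
  rw [sq (∑ e, ∑ s, r e s * u e s), Finset.sum_mul_sum]
  simp [add_comm]

/-- Jensen's inequality for the exponential, combined with Cauchy–Schwarz. -/
theorem exp_sub_sqrt_le_sum {Ω : Type*} [Fintype Ω] (w X L : Ω → ℝ) (hw : ∀ ω, 0 ≤ w ω)
    (hw1 : ∑ ω, w ω = 1) :
    Real.exp (∑ ω, w ω * X ω - 1 / 2 * Real.sqrt (∑ ω, w ω * L ω ^ 2))
      ≤ ∑ ω, w ω * Real.exp (X ω - |L ω| / 2) := by
  have h1 := convexOn_exp.map_sum_le (t := Finset.univ) (w := w) (p := fun ω => X ω - |L ω| / 2)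
    (fun ω _ => hw ω) hw1 (fun _ _ => Set.mem_univ _)
  simp only [smul_eq_mul] at h1
  refine le_trans (Real.exp_le_exp.mpr ?_) h1
  have h2 : ∑ ω, w ω * |L ω| ≤ Real.sqrt (∑ ω, w ω * L ω ^ 2) := by
    apply Real.le_sqrt_of_sq_le
    have := Finset.sum_sq_le_sum_mul_sum_of_sq_le_mul (Finset.univ : Finset Ω)
      (r := fun ω => w ω * |L ω|) (f := w) (g := fun ω => w ω * L ω ^ 2)
      (fun ω _ => hw ω) (fun ω _ => mul_nonneg (hw ω) (sq_nonneg _))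
      (fun ω _ => le_of_eq (by rw [mul_pow, sq_abs]; ring))
    rwa [hw1, one_mul] at this
  have h3 : ∑ ω, w ω * (X ω - |L ω| / 2) = ∑ ω, w ω * X ω - 1 / 2 * ∑ ω, w ω * |L ω| := by
    rw [Finset.mul_sum, ← Finset.sum_sub_distrib]
    exact Finset.sum_congr rfl fun ω _ => by ring
  rw [h3]
  linarith

/-- Resampling one coordinate leaves the uniform distribution on functions invariant. -/
theorem sum_sum_update {ι A : Type*} [Fintype ι] [DecidableEq ι] [Fintype A] (i : ι)
    (F : (ι → A) → ℝ) :
    ∑ σ : ι → A, ∑ a, F (Function.update σ i a) = Fintype.card A * ∑ σ : ι → A, F σ := by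
  have hinv : Function.Involutive
      (fun p : (ι → A) × A => (Function.update p.1 i p.2, p.1 i)) := by
    rintro ⟨σ, a⟩
    simp
  have h := Equiv.sum_comp (hinv.toPerm _) (fun p : (ι → A) × A => F p.1)
  simp only [Function.Involutive.coe_toPerm, Fintype.sum_prod_type] at h
  rw [h]
  simp [Finset.mul_sum]

theorem sum_update_le {ι A : Type*} [Fintype ι] [DecidableEq ι] [Fintype A] (i : ι)
    (F : (ι → A) → ℝ) (hF : ∀ σ, 0 ≤ F σ) (k : A) :
    ∑ σ : ι → A, F (Function.update σ i k) ≤ Fintype.card A * ∑ σ : ι → A, F σ := by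
  rw [← sum_sum_update i F]
  exact Finset.sum_le_sum fun σ _ => Finset.single_le_sum
    (f := fun a => F (Function.update σ i a)) (fun a _ => hF _) (Finset.mem_univ k)

theorem sum_update_add_update_le {ι A : Type*} [Fintype ι] [DecidableEq ι] [Fintype A]
    (i : ι) (F : (ι → A) → ℝ) (hF : ∀ σ, 0 ≤ F σ) {k l : A} (hkl : k ≠ l) :
    ∑ σ : ι → A, (F (Function.update σ i k) + F (Function.update σ i l))
      ≤ Fintype.card A * ∑ σ : ι → A, F σ := by
  classical
  rw [← sum_sum_update i F]
  refine Finset.sum_le_sum fun σ _ => ?_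
  rw [← Finset.sum_pair hkl (f := fun a => F (Function.update σ i a))]
  exact Finset.sum_le_univ_sum_of_nonneg fun a => hF _

/-- A sum over pairs containing `i` is a sum over the other nodes. -/
theorem sum_pairIdx_ite {N : ℕ} (i : Fin N) (u : Fin N → ℝ) :
    ∑ p : PairIdx N, (if p.1.1 = i then u p.1.2 else if p.1.2 = i then u p.1.1 else 0)
      = ∑ j, if j = i then 0 else u j := by
  rw [← Finset.sum_subtype (Finset.univ.filter fun p : Fin N × Fin N => p.1 < p.2) (by simp)
    (fun p : Fin N × Fin N => if p.1 = i then u p.2 else if p.2 = i then u p.1 else 0),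
    Finset.sum_filter, Fintype.sum_prod_type]
  have h : ∀ a b : Fin N,
      (if a < b then (if a = i then u b else if b = i then u a else 0) else 0)
        = (if a = i then (if i < b then u b else 0) else 0)
          + (if b = i then (if a < i then u a else 0) else 0) := by
    intro a b
    by_cases ha : a = i <;> by_cases hb : b = i <;> simp [ha, hb]
  simp_rw [h, Finset.sum_add_distrib]
  rw [Finset.sum_comm (f := fun a b => if a = i then (if i < b then u b else 0) else 0)]
  simp only [Finset.sum_ite_eq', Finset.mem_univ, if_true]
  rw [← Finset.sum_add_distrib]
  refine Finset.sum_congr rfl fun j _ => ?_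
  rcases lt_trichotomy j i with h | h | h
  · simp [h, h.ne, h.not_gt]
  · simp [h]
  · simp [h, h.ne', h.not_gt]

/-- Chernoff bound for the probability that some block has at most half its expected size. -/
theorem card_small_block_le (N K : ℕ) (hK : 0 < K) :
    ∑ σ : Fin N → Fin K,
        (if ∃ a, 2 * K * (Finset.univ.filter fun j => σ j = a).card ≤ N then (1 : ℝ) else 0)
      ≤ (K : ℝ) ^ N * (K * Real.exp (-(N : ℝ) / (8 * K))) := by
  have hK' : (0 : ℝ) < K := by exact_mod_cast hK
  set c : ℝ := Real.exp (Real.log 2 * (N / (2 * K))) with hc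
  have h1 : ∀ σ : Fin N → Fin K,
      (if ∃ a, 2 * K * (Finset.univ.filter fun j => σ j = a).card ≤ N then (1 : ℝ) else 0)
        ≤ ∑ a, c * ∏ j, (if σ j = a then (1 / 2 : ℝ) else 1) := by
    intro σ
    have h0 : ∀ a, 0 ≤ c * ∏ j, (if σ j = a then (1 / 2 : ℝ) else 1) := fun a =>
      mul_nonneg (Real.exp_nonneg _) (Finset.prod_nonneg fun j _ => by split_ifs <;> norm_num)
    split_ifs with h
    · obtain ⟨a, ha⟩ := h
      refine le_trans ?_ (Finset.single_le_sum (fun a _ => h0 a) (Finset.mem_univ a))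
      rw [← Finset.prod_filter, Finset.prod_const]
      set n := (Finset.univ.filter fun j => σ j = a).card
      have h2 : (1 / 2 : ℝ) ^ n = Real.exp (-(Real.log 2 * n)) := by
        rw [Real.exp_neg, mul_comm, ← Real.log_pow, Real.exp_log (by positivity)]
        simp
      rw [h2, hc, ← Real.exp_add]
      apply Real.one_le_exp
      have h3 : (n : ℝ) ≤ N / (2 * K) := by
        rw [le_div_iff₀ (by positivity)]
        have : ((2 * K * n : ℕ) : ℝ) ≤ N := by exact_mod_cast ha
        push_cast at this
        linarith
      have := mul_le_mul_of_nonneg_left h3 (Real.log_nonneg (by norm_num : (1 : ℝ) ≤ 2))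
      linarith
    · exact Finset.sum_nonneg fun a _ => h0 a
  refine (Finset.sum_le_sum fun σ _ => h1 σ).trans ?_
  rw [Finset.sum_comm]
  have h4 : ∀ a : Fin K, ∑ σ : Fin N → Fin K, c * ∏ j, (if σ j = a then (1 / 2 : ℝ) else 1)
      ≤ (K : ℝ) ^ N * Real.exp (-(N : ℝ) / (8 * K)) := by
    intro a
    rw [← Finset.mul_sum, ← Fintype.prod_sum fun (_ : Fin N) b => if b = a then (1 / 2 : ℝ) else 1]
    have h5 : ∑ b : Fin K, (if b = a then (1 / 2 : ℝ) else 1) = K * (1 + -(1 / (2 * K))) := by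
      have : ∀ b : Fin K, (if b = a then (1 / 2 : ℝ) else 1) = 1 - if b = a then 1 / 2 else 0 := by
        intro b; split_ifs <;> norm_num
      simp_rw [this]
      rw [Finset.sum_sub_distrib]
      simp
      field_simp
      ring
    have h1K : (1 : ℝ) ≤ K := by exact_mod_cast hK
    have h6 : (1 + -(1 / (2 * K)) : ℝ) ^ N ≤ Real.exp (-(1 / (2 * K))) ^ N := by
      apply pow_le_pow_left₀
      · have : 1 / (2 * (K : ℝ)) ≤ 1 := by
          rw [div_le_one (by positivity)]; linarith
        linarith
      · linarith [Real.add_one_le_exp (-(1 / (2 * (K : ℝ))))]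
    simp only [Finset.prod_const, Finset.card_univ, Fintype.card_fin]
    rw [h5, mul_pow, mul_left_comm]
    refine mul_le_mul_of_nonneg_left ?_ (by positivity)
    refine (mul_le_mul_of_nonneg_left h6 (Real.exp_nonneg _)).trans ?_
    rw [← Real.exp_nat_mul, ← Real.exp_add]
    apply Real.exp_le_exp.mpr
    have h7 : Real.log 2 * (N / (2 * K)) + N * -(1 / (2 * K))
        = (Real.log 2 - 1) / 2 * (N / K) := by
      field_simp
      ring
    have h8 : -(N : ℝ) / (8 * K) = -(1 / 8) * (N / K) := by
      field_simp
    rw [h7, h8]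
    refine mul_le_mul_of_nonneg_right ?_ (by positivity)
    linarith [Real.log_two_lt_d9]
  refine (Finset.sum_le_sum fun a _ => h4 a).trans ?_
  simp only [Finset.sum_const, Finset.card_univ, Fintype.card_fin, nsmul_eq_mul]
  linarith [mul_left_comm (K : ℝ) ((K : ℝ) ^ N) (Real.exp (-(N : ℝ) / (8 * K)))]

/-- Signed indicator of two labels. -/
noncomputable def labelSign {A : Type*} [DecidableEq A] (k l a : A) : ℝ :=
  (if a = k then 1 else 0) - (if a = l then 1 else 0)

theorem sum_labelSign {A : Type*} [Fintype A] [DecidableEq A] (k l : A) :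
    ∑ a, labelSign k l a = 0 := by
  simp [labelSign]

theorem sum_labelSign_sq {A : Type*} [Fintype A] [DecidableEq A] {k l : A} (hkl : k ≠ l) :
    ∑ a, labelSign k l a ^ 2 = 2 := by
  have h : ∀ a, labelSign k l a ^ 2 = (if a = k then 1 else 0) + if a = l then 1 else 0 := by
    intro a
    unfold labelSign
    by_cases h1 : a = k
    · subst h1
      simp [hkl]
    · by_cases h2 : a = l <;> simp [h1, h2, hkl.symm]
  simp_rw [h, Finset.sum_add_distrib]
  norm_num

/-- Sign with which a pair enters the log-likelihood ratio when the label of `i` is changed. -/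
noncomputable def pairSign {N K : ℕ} (k l : Fin K) (i : Fin N) (σ : Fin N → Fin K)
    (p : PairIdx N) : ℝ :=
  if p.1.1 = i then labelSign k l (σ p.1.2)
  else if p.1.2 = i then labelSign k l (σ p.1.1) else 0

theorem sum_pairSign {N K : ℕ} (k l : Fin K) (i : Fin N) (σ : Fin N → Fin K) :
    ∑ p, pairSign k l i σ p = ∑ j, if j = i then 0 else labelSign k l (σ j) :=
  sum_pairIdx_ite i fun j => labelSign k l (σ j)

theorem sum_pairSign_sq {N K : ℕ} (k l : Fin K) (i : Fin N) (σ : Fin N → Fin K) :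
    ∑ p, pairSign k l i σ p ^ 2 = ∑ j, if j = i then 0 else labelSign k l (σ j) ^ 2 := by
  rw [← sum_pairIdx_ite i fun j => labelSign k l (σ j) ^ 2]
  refine Finset.sum_congr rfl fun p _ => ?_
  unfold pairSign
  split_ifs <;> simp

theorem sum_uniform_pmf {N K : ℕ} (hK : 0 < K) (_ : Fin N) :
    ∑ _a : Fin K, (K : ℝ)⁻¹ = 1 := by
  have : (K : ℝ) ≠ 0 := by exact_mod_cast hK.ne'
  simp [this]

theorem prod_uniform {N K : ℕ} : ∏ _j : Fin N, (K : ℝ)⁻¹ = ((K : ℝ) ^ N)⁻¹ := by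
  simp

/-- Mean number of other nodes whose label is one of two given labels. -/
theorem sum_uniform_sum_pairSign_sq {N K : ℕ} (hK : 0 < K) {k l : Fin K} (hkl : k ≠ l)
    (i : Fin N) :
    ∑ σ : Fin N → Fin K, ((K : ℝ) ^ N)⁻¹ * ∑ p, pairSign k l i σ p ^ 2
      = ((N : ℝ) - 1) * (2 / K) := by
  simp_rw [sum_pairSign_sq, ← prod_uniform]
  rw [sum_prod_pmf_mul_sum (fun (_ : Fin N) (_ : Fin K) => (K : ℝ)⁻¹) (sum_uniform_pmf hK)
    (fun j a => if j = i then 0 else labelSign k l a ^ 2)]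
  have h : ∀ j : Fin N, ∑ a, (K : ℝ)⁻¹ * (if j = i then 0 else labelSign k l a ^ 2)
      = 2 / K - if j = i then 2 / (K : ℝ) else 0 := by
    intro j
    split_ifs
    · simp
    · rw [← Finset.mul_sum, sum_labelSign_sq hkl]
      ring
  simp_rw [h, Finset.sum_sub_distrib]
  simp
  ring

/-- Mean square of the difference of the sizes of two blocks, one node being left out. -/
theorem sum_uniform_sq_sum_pairSign {N K : ℕ} (hK : 0 < K) {k l : Fin K} (hkl : k ≠ l)
    (i : Fin N) :
    ∑ σ : Fin N → Fin K, ((K : ℝ) ^ N)⁻¹ * (∑ p, pairSign k l i σ p) ^ 2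
      = ((N : ℝ) - 1) * (2 / K) := by
  simp_rw [sum_pairSign, ← prod_uniform]
  rw [sum_prod_pmf_mul_sum_sq (fun (_ : Fin N) (_ : Fin K) => (K : ℝ)⁻¹) (sum_uniform_pmf hK)
    (fun j a => if j = i then 0 else labelSign k l a)]
  have h0 : ∀ j : Fin N, ∑ a, (K : ℝ)⁻¹ * (if j = i then 0 else labelSign k l a) = 0 := by
    intro j
    split_ifs
    · simp
    · rw [← Finset.mul_sum, sum_labelSign, mul_zero]
  have h : ∀ j : Fin N, ∑ a, (K : ℝ)⁻¹ * (if j = i then 0 else labelSign k l a) ^ 2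
      = 2 / K - if j = i then 2 / (K : ℝ) else 0 := by
    intro j
    split_ifs
    · simp
    · rw [← Finset.mul_sum, sum_labelSign_sq hkl]
      ring
  simp_rw [h0, h, Finset.sum_sub_distrib]
  simp
  ring

/-- Tilted distribution of a pair: the normalised geometric mean of its two laws. -/
noncomputable def tiltedPmf {N K : ℕ} {S : Type*} (f g h : S → ℝ) (k l : Fin K) (i : Fin N)
    (σ : Fin N → Fin K) (p : PairIdx N) (s : S) : ℝ :=
  if pairSign k l i σ p = 0 then
    (if Function.update σ i k p.1.1 = Function.update σ i k p.1.2 then f s else g s)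
  else h s

theorem pair_law_eq_tilted {N K : ℕ} {S : Type*} {f g h t : S → ℝ} {z : ℝ} {k l : Fin K}
    (hkl : k ≠ l) (hf : ∀ s, f s = Real.exp z * h s * Real.exp (t s / 2))
    (hg : ∀ s, g s = Real.exp z * h s * Real.exp (-(t s) / 2))
    (i : Fin N) (σ : Fin N → Fin K) (p : PairIdx N) (s : S) :
    (if Function.update σ i k p.1.1 = Function.update σ i k p.1.2 then f s else g s)
        = Real.exp (pairSign k l i σ p ^ 2 * z) * tiltedPmf f g h k l i σ p s
          * Real.exp (pairSign k l i σ p * t s / 2) ∧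
      (if Function.update σ i l p.1.1 = Function.update σ i l p.1.2 then f s else g s)
        = Real.exp (pairSign k l i σ p ^ 2 * z) * tiltedPmf f g h k l i σ p s
          * Real.exp (-(pairSign k l i σ p * t s) / 2) := by
  obtain ⟨⟨a, b⟩, hab⟩ := p
  have key : ∀ c : Fin K,
      (if k = c then f s else g s) = Real.exp (labelSign k l c ^ 2 * z)
          * (if labelSign k l c = 0 then (if k = c then f s else g s) else h s)
          * Real.exp (labelSign k l c * t s / 2) ∧
      (if l = c then f s else g s) = Real.exp (labelSign k l c ^ 2 * z)
          * (if labelSign k l c = 0 then (if k = c then f s else g s) else h s)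
          * Real.exp (-(labelSign k l c * t s) / 2) := by
    intro c
    by_cases h1 : k = c
    · subst h1
      simpa [labelSign, hkl, hkl.symm] using ⟨hf s, hg s⟩
    · by_cases h2 : l = c
      · subst h2
        simpa [labelSign, hkl, hkl.symm] using ⟨hg s, hf s⟩
      · simp [labelSign, h1, h2, Ne.symm h1, Ne.symm h2]
  by_cases ha : a = i
  · have hb : b ≠ i := fun h => by simp [ha, h] at hab
    subst ha
    simpa [tiltedPmf, pairSign, hb] using key (σ b)
  · by_cases hb : b = i
    · subst hb
      simpa [tiltedPmf, pairSign, ha, eq_comm] using key (σ a)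
    · simp [tiltedPmf, pairSign, ha, hb]

/-- The smaller of the two likelihoods in terms of the tilted distribution. -/
theorem tilted_le_min_sbmProb {N K : ℕ} {S : Type*} [Fintype S] {f g h t : S → ℝ} {z : ℝ}
    {k l : Fin K} (hkl : k ≠ l) (hf : ∀ s, f s = Real.exp z * h s * Real.exp (t s / 2))
    (hg : ∀ s, g s = Real.exp z * h s * Real.exp (-(t s) / 2))
    (hf0 : ∀ s, 0 ≤ f s) (hg0 : ∀ s, 0 ≤ g s) (hh0 : ∀ s, 0 ≤ h s)
    (i : Fin N) (σ : Fin N → Fin K) (x : PairIdx N → S) :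
    (∏ p, tiltedPmf f g h k l i σ p (x p))
        * Real.exp ((∑ p, pairSign k l i σ p ^ 2) * z - |∑ p, pairSign k l i σ p * t (x p)| / 2)
      ≤ min (sbmProb f g (Function.update σ i k) x) (sbmProb f g (Function.update σ i l) x) := by
  have h0 : 0 ≤ ∏ p, tiltedPmf f g h k l i σ p (x p) := by
    refine Finset.prod_nonneg fun p _ => ?_
    unfold tiltedPmf
    split_ifs
    exacts [hf0 _, hg0 _, hh0 _]
  have h1 : sbmProb f g (Function.update σ i k) x
      = (∏ p, tiltedPmf f g h k l i σ p (x p)) * Real.exp ((∑ p, pairSign k l i σ p ^ 2) * z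
          + (∑ p, pairSign k l i σ p * t (x p)) / 2) := by
    unfold sbmProb
    rw [Finset.prod_congr rfl fun p _ => (pair_law_eq_tilted hkl hf hg i σ p (x p)).1,
      Finset.prod_mul_distrib, Finset.prod_mul_distrib, ← Real.exp_sum, ← Real.exp_sum,
      Real.exp_add, Finset.sum_mul, Finset.sum_div]
    ring
  have h2 : sbmProb f g (Function.update σ i l) x
      = (∏ p, tiltedPmf f g h k l i σ p (x p)) * Real.exp ((∑ p, pairSign k l i σ p ^ 2) * z
          - (∑ p, pairSign k l i σ p * t (x p)) / 2) := by
    unfold sbmProb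
    rw [Finset.prod_congr rfl fun p _ => (pair_law_eq_tilted hkl hf hg i σ p (x p)).2,
      Finset.prod_mul_distrib, Finset.prod_mul_distrib, ← Real.exp_sum, ← Real.exp_sum,
      sub_eq_add_neg, Real.exp_add, Finset.sum_mul, ← neg_div, ← Finset.sum_neg_distrib,
      Finset.sum_div]
    ring
  rw [h1, h2]
  refine le_min ?_ ?_ <;> refine mul_le_mul_of_nonneg_left (Real.exp_le_exp.mpr ?_) h0
  · linarith [neg_abs_le (∑ p, pairSign k l i σ p * t (x p))]
  · linarith [le_abs_self (∑ p, pairSign k l i σ p * t (x p))]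

theorem sum_tiltedPmf {N K : ℕ} {S : Type*} [Fintype S] {f g h : S → ℝ}
    (hf1 : ∑ s, f s = 1) (hg1 : ∑ s, g s = 1) (hh1 : ∑ s, h s = 1) (k l : Fin K)
    (i : Fin N) (σ : Fin N → Fin K) (p : PairIdx N) : ∑ s, tiltedPmf f g h k l i σ p s = 1 := by
  unfold tiltedPmf
  split_ifs <;> assumption

/-- Second moment of the log-likelihood ratio under the tilted distribution. -/
theorem sum_tilted_mul_sq {N K : ℕ} {S : Type*} [Fintype S] {f g h : S → ℝ} (t : S → ℝ)
    (hf1 : ∑ s, f s = 1) (hg1 : ∑ s, g s = 1) (hh1 : ∑ s, h s = 1) (k l : Fin K)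
    (i : Fin N) (σ : Fin N → Fin K) :
    ∑ x : PairIdx N → S, (∏ p, tiltedPmf f g h k l i σ p (x p))
        * (∑ p, pairSign k l i σ p * t (x p)) ^ 2
      = (∑ p, pairSign k l i σ p ^ 2) * (∑ s, h s * t s ^ 2 - (∑ s, h s * t s) ^ 2)
        + (∑ p, pairSign k l i σ p) ^ 2 * (∑ s, h s * t s) ^ 2 := by
  rw [sum_prod_pmf_mul_sum_sq _ (sum_tiltedPmf hf1 hg1 hh1 k l i σ)
    (fun p s => pairSign k l i σ p * t s)]
  have h1 : ∀ p, ∑ s, tiltedPmf f g h k l i σ p s * (pairSign k l i σ p * t s)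
      = pairSign k l i σ p * ∑ s, h s * t s := by
    intro p
    by_cases hp : pairSign k l i σ p = 0
    · simp [hp]
    · rw [Finset.mul_sum]
      refine Finset.sum_congr rfl fun s _ => ?_
      rw [tiltedPmf, if_neg hp]
      ring
  have h2 : ∀ p, ∑ s, tiltedPmf f g h k l i σ p s * (pairSign k l i σ p * t s) ^ 2
      = pairSign k l i σ p ^ 2 * ∑ s, h s * t s ^ 2 := by
    intro p
    by_cases hp : pairSign k l i σ p = 0
    · simp [hp]
    · rw [Finset.mul_sum]
      refine Finset.sum_congr rfl fun s _ => ?_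
      rw [tiltedPmf, if_neg hp]
      ring
  simp_rw [h1, h2, mul_pow, ← mul_sub, ← Finset.sum_mul, mul_pow]

/-- Average overlap of the laws of two models differing in the label of one node. -/
theorem exp_le_sum_min_sbmProb {N K : ℕ} (hK : 0 < K) {S : Type*} [Fintype S]
    {f g h t : S → ℝ} {z : ℝ} {k l : Fin K} (hkl : k ≠ l)
    (hf : ∀ s, f s = Real.exp z * h s * Real.exp (t s / 2))
    (hg : ∀ s, g s = Real.exp z * h s * Real.exp (-(t s) / 2))
    (hf0 : ∀ s, 0 ≤ f s) (hg0 : ∀ s, 0 ≤ g s) (hh0 : ∀ s, 0 ≤ h s)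
    (hf1 : ∑ s, f s = 1) (hg1 : ∑ s, g s = 1) (hh1 : ∑ s, h s = 1) (i : Fin N) :
    (K : ℝ) ^ N * Real.exp (((N : ℝ) - 1) * (2 / K) * z
        - 1 / 2 * Real.sqrt (((N : ℝ) - 1) * (2 / K) * ∑ s, h s * t s ^ 2))
      ≤ ∑ σ : Fin N → Fin K, ∑ x : PairIdx N → S,
        min (sbmProb f g (Function.update σ i k) x) (sbmProb f g (Function.update σ i l) x) := by
  have hKN : (0 : ℝ) < (K : ℝ) ^ N := by positivity
  have hR0 : ∀ (σ : Fin N → Fin K) (x : PairIdx N → S),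
      0 ≤ ∏ p, tiltedPmf f g h k l i σ p (x p) := by
    intro σ x
    refine Finset.prod_nonneg fun p _ => ?_
    unfold tiltedPmf
    split_ifs
    exacts [hf0 _, hg0 _, hh0 _]
  have hR1 : ∀ σ : Fin N → Fin K, ∑ x : PairIdx N → S, ∏ p, tiltedPmf f g h k l i σ p (x p) = 1 :=
    fun σ => sum_prod_pmf _ (sum_tiltedPmf hf1 hg1 hh1 k l i σ)
  have hJ := exp_sub_sqrt_le_sum (Ω := (Fin N → Fin K) × (PairIdx N → S))
    (fun ω => ((K : ℝ) ^ N)⁻¹ * ∏ p, tiltedPmf f g h k l i ω.1 p (ω.2 p))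
    (fun ω => (∑ p, pairSign k l i ω.1 p ^ 2) * z)
    (fun ω => ∑ p, pairSign k l i ω.1 p * t (ω.2 p))
    (fun ω => mul_nonneg (inv_nonneg.mpr hKN.le) (hR0 _ _))
    (by
      rw [Fintype.sum_prod_type]
      simp_rw [← Finset.mul_sum, hR1]
      simp [hKN.ne'])
  simp only [Fintype.sum_prod_type] at hJ
  have hX : ∑ σ : Fin N → Fin K, ∑ x : PairIdx N → S,
      ((K : ℝ) ^ N)⁻¹ * (∏ p, tiltedPmf f g h k l i σ p (x p))
        * ((∑ p, pairSign k l i σ p ^ 2) * z) = ((N : ℝ) - 1) * (2 / K) * z := by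
    simp_rw [← Finset.sum_mul, ← Finset.mul_sum, hR1, mul_one, ← mul_assoc]
    rw [← Finset.sum_mul, sum_uniform_sum_pairSign_sq hK hkl i]
  have hL : ∑ σ : Fin N → Fin K, ∑ x : PairIdx N → S,
      ((K : ℝ) ^ N)⁻¹ * (∏ p, tiltedPmf f g h k l i σ p (x p))
        * (∑ p, pairSign k l i σ p * t (x p)) ^ 2
        = ((N : ℝ) - 1) * (2 / K) * ∑ s, h s * t s ^ 2 := by
    simp_rw [mul_assoc ((K : ℝ) ^ N)⁻¹, ← Finset.mul_sum,
      sum_tilted_mul_sq t hf1 hg1 hh1 k l i]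
    simp_rw [Finset.sum_add_distrib, ← Finset.sum_mul, mul_add, ← mul_assoc]
    have h1 := sum_uniform_sum_pairSign_sq hK hkl i
    have h2 := sum_uniform_sq_sum_pairSign hK hkl i
    rw [← Finset.mul_sum] at h1 h2
    rw [h1, h2]
    ring
  rw [hX, hL] at hJ
  rw [← le_inv_mul_iff₀ hKN]
  refine hJ.trans ?_
  simp_rw [mul_assoc, ← Finset.mul_sum]
  refine mul_le_mul_of_nonneg_left ?_ (inv_nonneg.mpr hKN.le)
  exact Finset.sum_le_sum fun σ _ => Finset.sum_le_sum fun x _ =>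
    tilted_le_min_sbmProb hkl hf hg hf0 hg0 hh0 i σ x

/-- Two relabellings which both nearly match a labelling with large blocks coincide. -/
theorem perm_eq_of_ham_le {N K : ℕ} {σ σ' τ : Fin N → Fin K} {i : Fin N}
    (hσ : ∀ j, j ≠ i → σ j = σ' j) {ρ ρ' : Equiv.Perm (Fin K)}
    (hblock : ∀ a, 2 * ham σ (fun j => ρ (τ j)) + ham σ' (fun j => ρ' (τ j)) + 1
      < (Finset.univ.filter fun j => σ j = a).card) : ρ = ρ' := by
  by_contra hne
  obtain ⟨a, ha⟩ : ∃ a, ρ a ≠ ρ' a := by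
    by_contra! h
    exact hne (Equiv.ext h)
  have hsub : (Finset.univ.filter fun j => σ j = ρ a)
      ⊆ ((Finset.univ.filter fun j => σ j ≠ ρ (τ j)) ∪
        (Finset.univ.filter fun j => σ' j ≠ ρ' (τ j))) ∪ {i} := by
    intro j hj
    simp only [Finset.mem_filter, Finset.mem_univ, true_and, Finset.mem_union,
      Finset.mem_singleton] at hj ⊢
    by_contra! h
    obtain ⟨⟨h1, h2⟩, h3⟩ := h
    have h4 : τ j = a := ρ.injective (h1.symm.trans hj)
    rw [← hσ j h3, hj, h4] at h2
    exact ha h2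
  have h1 := (Finset.card_le_card hsub).trans (Finset.card_union_le _ _)
  have h2 := Finset.card_union_le (Finset.univ.filter fun j => σ j ≠ ρ (τ j))
    (Finset.univ.filter fun j => σ' j ≠ ρ' (τ j))
  have h3 := hblock (ρ a)
  unfold ham at h3
  beta_reduce at h3
  simp only [Finset.card_singleton] at h1
  omega

theorem exists_perm_hamStar {N K : ℕ} (σ τ : Fin N → Fin K) :
    ∃ ρ : Equiv.Perm (Fin K), hamStar σ τ = ham σ fun j => ρ (τ j) := by
  obtain ⟨ρ, -, h⟩ := Finset.exists_mem_eq_inf' Finset.univ_nonempty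
    fun ρ : Equiv.Perm (Fin K) => ham σ fun i => ρ (τ i)
  exact ⟨ρ, h⟩

/-- A relabelling attaining the absolute classification error. -/
noncomputable def optPerm {N K : ℕ} (σ τ : Fin N → Fin K) : Equiv.Perm (Fin K) :=
  (exists_perm_hamStar σ τ).choose

theorem hamStar_eq_ham_optPerm {N K : ℕ} (σ τ : Fin N → Fin K) :
    hamStar σ τ = ham σ fun j => optPerm σ τ (τ j) :=
  (exists_perm_hamStar σ τ).choose_spec

/-- Indicator of misclassifying a node, augmented by the indicator of a large total error. -/
noncomputable def nodeLoss {N K : ℕ} (i : Fin N) (σ τ : Fin N → Fin K) : ℝ :=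
  (if σ i ≠ optPerm σ τ (τ i) then 1 else 0) + if N < 8 * K * hamStar σ τ then 1 else 0

theorem nodeLoss_nonneg {N K : ℕ} (i : Fin N) (σ τ : Fin N → Fin K) : 0 ≤ nodeLoss i σ τ := by
  unfold nodeLoss
  split_ifs <;> norm_num

theorem sum_nodeLoss_le {N K : ℕ} (σ τ : Fin N → Fin K) :
    ∑ i, nodeLoss i σ τ ≤ (1 + 8 * K) * (hamStar σ τ : ℝ) := by
  unfold nodeLoss
  rw [Finset.sum_add_distrib, Finset.sum_boole, Finset.sum_const, Finset.card_univ,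
    Fintype.card_fin, nsmul_eq_mul]
  have h1 : ((Finset.univ.filter fun i => σ i ≠ optPerm σ τ (τ i)).card : ℝ)
      = hamStar σ τ := by
    rw [hamStar_eq_ham_optPerm]
    rfl
  have h2 : (N : ℝ) * (if N < 8 * K * hamStar σ τ then 1 else 0) ≤ 8 * K * hamStar σ τ := by
    split_ifs with h
    · rw [mul_one]
      exact_mod_cast h.le
    · rw [mul_zero]
      positivity
  rw [h1]
  linarith

/-- An estimate cannot be good for both of two labellings differing at a single node. -/
theorem one_le_nodeLoss_add {N K : ℕ} (hKN : 8 * K < N) {k l : Fin K} (hkl : k ≠ l)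
    (i : Fin N) (σ τ : Fin N → Fin K)
    (hblock : ∀ a, N < 2 * K * (Finset.univ.filter fun j => Function.update σ i k j = a).card) :
    1 ≤ nodeLoss i (Function.update σ i k) τ + nodeLoss i (Function.update σ i l) τ := by
  have h1 := nodeLoss_nonneg i (Function.update σ i k) τ
  have h2 := nodeLoss_nonneg i (Function.update σ i l) τ
  by_contra! hlt
  have hk : ¬ N < 8 * K * hamStar (Function.update σ i k) τ := by
    intro h
    have : 1 ≤ nodeLoss i (Function.update σ i k) τ := by
      unfold nodeLoss
      rw [if_pos h]
      split_ifs <;> norm_num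
    linarith
  have hl : ¬ N < 8 * K * hamStar (Function.update σ i l) τ := by
    intro h
    have : 1 ≤ nodeLoss i (Function.update σ i l) τ := by
      unfold nodeLoss
      rw [if_pos h]
      split_ifs <;> norm_num
    linarith
  have hρ : optPerm (Function.update σ i k) τ = optPerm (Function.update σ i l) τ := by
    apply perm_eq_of_ham_le (σ := Function.update σ i k) (σ' := Function.update σ i l) (i := i)
      (τ := τ) (fun j hj => by simp [hj])
    intro a
    rw [← hamStar_eq_ham_optPerm, ← hamStar_eq_ham_optPerm]
    have h3 := hblock a
    by_contra! h4
    have h5 := Nat.mul_le_mul_left (8 * K) h4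
    nlinarith
  unfold nodeLoss at hlt
  rw [if_neg hk, if_neg hl, hρ] at hlt
  simp only [Function.update_self, add_zero] at hlt
  split_ifs at hlt with h3 h4 h4
  · norm_num at hlt
  · norm_num at hlt
  · norm_num at hlt
  · push Not at h3 h4
    exact hkl (h3.trans h4.symm)

theorem sbmProb_nonneg {N K : ℕ} {S : Type*} [Fintype S] {f g : S → ℝ} (hf0 : ∀ s, 0 ≤ f s)
    (hg0 : ∀ s, 0 ≤ g s) (σ : Fin N → Fin K) (x : PairIdx N → S) : 0 ≤ sbmProb f g σ x := by
  refine Finset.prod_nonneg fun p _ => ?_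
  split_ifs
  exacts [hf0 _, hg0 _]

theorem sum_sbmProb {N K : ℕ} {S : Type*} [Fintype S] {f g : S → ℝ} (hf1 : ∑ s, f s = 1)
    (hg1 : ∑ s, g s = 1) (σ : Fin N → Fin K) : ∑ x : PairIdx N → S, sbmProb f g σ x = 1 := by
  unfold sbmProb
  refine sum_prod_pmf
    (fun (p : PairIdx N) s => if σ p.1.1 = σ p.1.2 then f s else g s) fun p => ?_
  split_ifs <;> assumption

/-- Total error at one node, bounded below by the overlap of neighbouring models. -/
theorem sum_min_sbmProb_le {N K : ℕ} (hK : 0 < K) (hKN : 8 * K < N) {S : Type*} [Fintype S]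
    {f g : S → ℝ} (hf0 : ∀ s, 0 ≤ f s) (hg0 : ∀ s, 0 ≤ g s) (hf1 : ∑ s, f s = 1)
    (hg1 : ∑ s, g s = 1) {k l : Fin K} (hkl : k ≠ l) (i : Fin N)
    (τ : (PairIdx N → S) → Fin N → Fin K) :
    ∑ σ : Fin N → Fin K, ∑ x : PairIdx N → S,
        min (sbmProb f g (Function.update σ i k) x) (sbmProb f g (Function.update σ i l) x)
      ≤ K * (∑ σ : Fin N → Fin K, ∑ x, sbmProb f g σ x * nodeLoss i σ (τ x))
        + K * ((K : ℝ) ^ N * (K * Real.exp (-(N : ℝ) / (8 * K)))) := by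
  classical
  set F : (Fin N → Fin K) → ℝ := fun σ => ∑ x, sbmProb f g σ x * nodeLoss i σ (τ x) with hF
  set B : (Fin N → Fin K) → ℝ := fun σ =>
    if ∃ a, 2 * K * (Finset.univ.filter fun j => σ j = a).card ≤ N then (1 : ℝ) else 0 with hB
  have hF0 : ∀ σ, 0 ≤ F σ := fun σ => Finset.sum_nonneg fun x _ =>
    mul_nonneg (sbmProb_nonneg hf0 hg0 σ x) (nodeLoss_nonneg i σ (τ x))
  have hB0 : ∀ σ, 0 ≤ B σ := fun σ => by
    simp only [hB]
    split_ifs <;> norm_num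
  have hpoint : ∀ σ : Fin N → Fin K, ∑ x : PairIdx N → S,
      min (sbmProb f g (Function.update σ i k) x) (sbmProb f g (Function.update σ i l) x)
        ≤ (F (Function.update σ i k) + F (Function.update σ i l)) + B (Function.update σ i k) := by
    intro σ
    by_cases hbad : ∃ a, 2 * K * (Finset.univ.filter fun j => Function.update σ i k j = a).card ≤ N
    · have h1 : B (Function.update σ i k) = 1 := if_pos hbad
      have h2 : ∑ x : PairIdx N → S,
          min (sbmProb f g (Function.update σ i k) x) (sbmProb f g (Function.update σ i l) x)
            ≤ 1 := by
        rw [← sum_sbmProb hf1 hg1 (Function.update σ i k)]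
        exact Finset.sum_le_sum fun x _ => min_le_left _ _
      linarith [hF0 (Function.update σ i k), hF0 (Function.update σ i l)]
    · have h1 : B (Function.update σ i k) = 0 := if_neg hbad
      push Not at hbad
      rw [h1, add_zero, hF, ← Finset.sum_add_distrib]
      refine Finset.sum_le_sum fun x _ => ?_
      have h2 := one_le_nodeLoss_add hKN hkl i σ (τ x) hbad
      have h3 := nodeLoss_nonneg i (Function.update σ i k) (τ x)
      have h4 := nodeLoss_nonneg i (Function.update σ i l) (τ x)
      have h5 := mul_le_mul_of_nonneg_right (min_le_left (sbmProb f g (Function.update σ i k) x)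
        (sbmProb f g (Function.update σ i l) x)) h3
      have h6 := mul_le_mul_of_nonneg_right (min_le_right (sbmProb f g (Function.update σ i k) x)
        (sbmProb f g (Function.update σ i l) x)) h4
      have h7 := mul_le_mul_of_nonneg_left h2
        (le_min (sbmProb_nonneg hf0 hg0 (Function.update σ i k) x)
          (sbmProb_nonneg hf0 hg0 (Function.update σ i l) x))
      linarith
  refine (Finset.sum_le_sum fun σ _ => hpoint σ).trans ?_
  rw [Finset.sum_add_distrib]
  refine add_le_add ?_ ?_
  · simpa using sum_update_add_update_le i F hF0 hkl
  · refine (sum_update_le i B hB0 k).trans ?_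
    rw [Fintype.card_fin]
    exact mul_le_mul_of_nonneg_left (card_small_block_le N K hK) (Nat.cast_nonneg K)

/-- Lower bound for the expected relative classification error of any estimator in a
homogeneous SBM with uniformly distributed labels. -/
theorem lower_bound_homogeneous_sbm
    (N K : ℕ) (hK : 2 ≤ K) (S : Type*) [Fintype S]
    (f g : S → ℝ) (hfpos : ∀ x, 0 < f x) (hgpos : ∀ x, 0 < g x)
    (hf1 : ∑ x, f x = 1) (hg1 : ∑ x, g x = 1)
    (Z I J I21 : ℝ) (h : S → ℝ)
    (hZ : Z = ∑ x, Real.sqrt (f x * g x))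
    (hI : I = -2 * Real.log Z)
    (hh : ∀ x, h x = Z⁻¹ * Real.sqrt (f x * g x))
    (hJ : J = ∑ x, h x * (Real.log (f x / g x)) ^ 2)
    (hI21 : I21 = (1 / 2 - (K : ℝ)⁻¹) * (K : ℝ)⁻¹ * I ^ 2 + (1 / 2) * (K : ℝ)⁻¹ * J)
    (hN : (N : ℝ) ≥ 8 * K * Real.log (4 * (K : ℝ) ^ 2))
    (σhat : (PairIdx N → S) → (Fin N → Fin K)) :
    (∑ σ : Fin N → Fin K, ∑ x : PairIdx N → S,
        ((K : ℝ) ^ N)⁻¹ * sbmProb f g σ x * ((hamStar σ (σhat x) : ℝ) / N))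
      ≥ (1 / 84) * ((K : ℝ) ^ 3)⁻¹ *
          Real.exp (-((N : ℝ) / K) * I - Real.sqrt (8 * N * I21))
        - (1 / 6) * Real.exp (-(N : ℝ) / (8 * K)) := by
  have hK0 : 0 < K := by omega
  have hK2 : (2 : ℝ) ≤ K := by exact_mod_cast hK
  have hKpos : (0 : ℝ) < K := by linarith
  have hKN : 8 * K < N := by
    have h1 : 1 < Real.log (4 * (K : ℝ) ^ 2) := by
      rw [Real.lt_log_iff_exp_lt (by positivity)]
      have := Real.exp_one_lt_d9
      nlinarith
    have h2 : (8 * K : ℝ) < N := by nlinarith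
    exact_mod_cast h2
  have hNpos : (0 : ℝ) < N := by
    have : 0 < N := by omega
    exact_mod_cast this
  have hfg : ∀ s, 0 < Real.sqrt (f s * g s) := fun s =>
    Real.sqrt_pos.mpr (mul_pos (hfpos s) (hgpos s))
  have hS : Nonempty S := by
    by_contra hS
    rw [not_nonempty_iff] at hS
    simp at hf1
  have hZpos : 0 < Z := hZ ▸ Finset.sum_pos (fun s _ => hfg s) Finset.univ_nonempty
  have hZ1 : Z ≤ 1 := by
    have h1 : ∀ s, Real.sqrt (f s * g s) ≤ (f s + g s) / 2 := fun s => by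
      apply Real.sqrt_le_iff.mpr
      constructor
      · linarith [hfpos s, hgpos s]
      · nlinarith [sq_nonneg (f s - g s)]
    rw [hZ]
    refine (Finset.sum_le_sum fun s _ => h1 s).trans ?_
    rw [← Finset.sum_div, Finset.sum_add_distrib, hf1, hg1]
    norm_num
  have hI0 : 0 ≤ I := by
    rw [hI]
    linarith [Real.log_nonpos hZpos.le hZ1]
  have hh0 : ∀ s, 0 ≤ h s := fun s => by
    rw [hh]
    exact mul_nonneg (inv_nonneg.mpr hZpos.le) (hfg s).le
  have hh1 : ∑ s, h s = 1 := by
    simp_rw [hh, ← Finset.mul_sum]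
    rw [← hZ, inv_mul_cancel₀ hZpos.ne']
  have hZh : ∀ s, Real.exp (Real.log Z) * h s = Real.sqrt (f s * g s) := fun s => by
    rw [Real.exp_log hZpos, hh, mul_inv_cancel_left₀ hZpos.ne']
  have hft : ∀ s, f s = Real.exp (Real.log Z) * h s * Real.exp (Real.log (f s / g s) / 2) := by
    intro s
    have h1 := hfpos s
    have h2 := hgpos s
    rw [hZh, Real.exp_half, Real.exp_log (div_pos h1 h2), ← Real.sqrt_mul (mul_pos h1 h2).le]
    rw [show f s * g s * (f s / g s) = f s ^ 2 by field_simp, Real.sqrt_sq h1.le]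
  have hgt : ∀ s, g s = Real.exp (Real.log Z) * h s * Real.exp (-Real.log (f s / g s) / 2) := by
    intro s
    have h1 := hfpos s
    have h2 := hgpos s
    rw [hZh, Real.exp_half, ← Real.log_inv, Real.exp_log (inv_pos.mpr (div_pos h1 h2)),
      ← Real.sqrt_mul (mul_pos h1 h2).le]
    rw [show f s * g s * (f s / g s)⁻¹ = g s ^ 2 by field_simp, Real.sqrt_sq h2.le]
  have hJ0 : 0 ≤ J := by
    rw [hJ]
    exact Finset.sum_nonneg fun s _ => mul_nonneg (hh0 s) (sq_nonneg _)
  set A : ℝ := Real.exp (-((N : ℝ) / K) * I - Real.sqrt (8 * N * I21)) with hA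
  set e : ℝ := Real.exp (-(N : ℝ) / (8 * K)) with he
  set E : ℝ := ∑ σ : Fin N → Fin K, ∑ x : PairIdx N → S,
    ((K : ℝ) ^ N)⁻¹ * sbmProb f g σ x * ((hamStar σ (σhat x) : ℝ) / N) with hE
  have hApos : 0 < A := Real.exp_pos _
  have hepos : 0 < e := Real.exp_pos _
  have hexp : A ≤ Real.exp (((N : ℝ) - 1) * (2 / K) * Real.log Z
      - 1 / 2 * Real.sqrt (((N : ℝ) - 1) * (2 / K) *
        ∑ s, h s * Real.log (f s / g s) ^ 2)) := by
    apply Real.exp_le_exp.mpr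
    rw [← hJ]
    have h1 : ((N : ℝ) - 1) * (2 / K) * Real.log Z = -((N : ℝ) / K) * I + I / K := by
      rw [hI]
      field_simp
      ring
    have h2 : 0 ≤ I / K := by positivity
    have h3 : ((N : ℝ) - 1) * (2 / K) * J ≤ 8 * N * I21 := by
      have h4 : (1 / 2) * (K : ℝ)⁻¹ * J ≤ I21 := by
        rw [hI21]
        have : 0 ≤ (1 / 2 - (K : ℝ)⁻¹) := by
          rw [sub_nonneg, ← one_div]
          exact one_div_le_one_div_of_le (by norm_num) hK2
        have : 0 ≤ (1 / 2 - (K : ℝ)⁻¹) * (K : ℝ)⁻¹ * I ^ 2 := by positivity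
        linarith
      have h5 : 0 ≤ (K : ℝ)⁻¹ * J := by positivity
      have h6 : 8 * N * ((1 / 2) * (K : ℝ)⁻¹ * J) ≤ 8 * N * I21 :=
        mul_le_mul_of_nonneg_left h4 (by positivity)
      rw [div_eq_mul_inv]
      nlinarith
    have h7 := Real.sqrt_le_sqrt h3
    have h8 := Real.sqrt_nonneg (((N : ℝ) - 1) * (2 / K) * J)
    linarith
  have hkl : (⟨0, hK0⟩ : Fin K) ≠ ⟨1, by omega⟩ := by simp
  have hnode : ∀ i : Fin N, (K : ℝ) ^ N * A
      ≤ K * (∑ σ : Fin N → Fin K, ∑ x, sbmProb f g σ x * nodeLoss i σ (σhat x))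
        + K * ((K : ℝ) ^ N * (K * e)) := fun i =>
    (mul_le_mul_of_nonneg_left hexp (by positivity)).trans <|
      (exp_le_sum_min_sbmProb hK0 hkl hft hgt (fun s => (hfpos s).le) (fun s => (hgpos s).le)
        hh0 hf1 hg1 hh1 i).trans <|
      sum_min_sbmProb_le hK0 hKN (fun s => (hfpos s).le) (fun s => (hgpos s).le) hf1 hg1 hkl i σhat
  have hsum : ∑ i : Fin N, ∑ σ : Fin N → Fin K, ∑ x, sbmProb f g σ x * nodeLoss i σ (σhat x)
      ≤ (1 + 8 * K) * (N * (K : ℝ) ^ N * E) := by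
    rw [Finset.sum_comm, hE, Finset.mul_sum, Finset.mul_sum]
    refine Finset.sum_le_sum fun σ _ => ?_
    rw [Finset.sum_comm, Finset.mul_sum, Finset.mul_sum]
    refine Finset.sum_le_sum fun x _ => ?_
    rw [← Finset.mul_sum]
    refine (mul_le_mul_of_nonneg_left (sum_nodeLoss_le σ (σhat x)) (sbmProb_nonneg
      (fun s => (hfpos s).le) (fun s => (hgpos s).le) σ x)).trans (le_of_eq ?_)
    field_simp
  have hall := Finset.sum_le_sum fun (i : Fin N) (_ : i ∈ Finset.univ) => hnode i
  rw [Finset.sum_add_distrib] at hall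
  simp only [← Finset.mul_sum, Finset.sum_const, Finset.card_univ, Fintype.card_fin, nsmul_eq_mul] at hall
  have hmain : A ≤ K * (1 + 8 * K) * E + K ^ 2 * e := by
    have h1 : (0 : ℝ) < N * (K : ℝ) ^ N := by positivity
    refine le_of_mul_le_mul_left ?_ h1
    have := mul_le_mul_of_nonneg_left hsum hKpos.le
    linarith
  have h1 : (A - K ^ 2 * e) / (K * (1 + 8 * K)) ≤ E := by
    rw [div_le_iff₀ (by positivity)]
    linarith
  have h2 : (1 / 84) * ((K : ℝ) ^ 3)⁻¹ * A ≤ A / (K * (1 + 8 * K)) := by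
    rw [one_div, ← mul_inv, div_eq_inv_mul]
    refine mul_le_mul_of_nonneg_right (inv_anti₀ (by positivity) ?_) hApos.le
    nlinarith [mul_pos hKpos hKpos, mul_nonneg (sq_nonneg (K : ℝ)) (sub_nonneg.mpr hK2)]
  have h3 : K ^ 2 * e / (K * (1 + 8 * K)) ≤ (1 / 6) * e := by
    rw [div_le_iff₀ (by positivity)]
    nlinarith [mul_pos hKpos hepos, mul_pos (mul_pos hKpos hKpos) hepos]
  rw [sub_div] at h1
  linarith
end

section
/- Let f, g be strictly positive probability mass functions on a finite set S, let K ≥ 2, let α be a probability vector on {1,…,K}, and let 𝒦 ⊂ {1,…,K} with |𝒦| ≥ 2 and α_k > 0 for all k ∈ 𝒦. For probability mass functions f*_1,…,f*_K on S define I_1(f*_1,…,f*_K) = ∑_{k∈𝒦} ∑_{ℓ=1}^K α*_k α_ℓ d_KL(f*_ℓ ‖ f_{kℓ}), where α*_k = α_k / ∑_{j∈𝒦} α_j and f_{kℓ} = f if k = ℓ, f_{kℓ} = g otherwise. Then: (a) the minimum of I_1 over all probability mass functions f*_1,…,f*_K equals ∑_{k∈𝒦} α*_k α_k D_{1−α*_k}(g‖f),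 and it is attained by f*_k = Z_{α*_k}^{-1} f^{α*_k} g^{1−α*_k} for k ∈ 𝒦 and f*_k = g otherwise, where Z_β = ∑_{x∈S} f(x)^β g(x)^{1−β}; (b) if α is the uniform distribution on {1,…,K}, then the minimum over all 𝒦 with |𝒦| ≥ 2 and all f*_1,…,f*_K equals K^{-1} D_{1/2}(f‖g). -/
open Finset

/-- Kullback–Leibler divergence between probability mass functions on a finite set. -/
noncomputable def dKL {S : Type*} [Fintype S] (p q : S → ℝ) : ℝ :=
  ∑ x, p x * Real.log (p x / q x)

/-- Rényi divergence of order `a` between probability mass functions on a finite set. -/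
noncomputable def renyiDiv {S : Type*} [Fintype S] (a : ℝ) (p q : S → ℝ) : ℝ :=
  (a - 1)⁻¹ * Real.log (∑ x, p x ^ a * q x ^ (1 - a))

/-- The functional `I₁` of the reference distributions `f*`, for the homogeneous SBM with
intra-block distribution `f` and inter-block distribution `g`. -/
noncomputable def I1fun {K : ℕ} {S : Type*} [Fintype S] (α : Fin K → ℝ) (f g : S → ℝ)
    (𝒦 : Finset (Fin K)) (fstar : Fin K → S → ℝ) : ℝ :=
  ∑ k ∈ 𝒦, ∑ l, (α k / ∑ j ∈ 𝒦, α j) * α l * dKL (fstar l) (if k = l then f else g)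

/-- The Hellinger-type affinity `∑ f ^ a * g ^ (1 - a)`. -/
noncomputable def affinity {S : Type*} [Fintype S] (f g : S → ℝ) (a : ℝ) : ℝ :=
  ∑ y, f y ^ a * g y ^ (1 - a)

/-- The normalized geometric mixture of `f` and `g`. -/
noncomputable def geomMixture {S : Type*} [Fintype S] (f g : S → ℝ) (a : ℝ) (x : S) : ℝ :=
  (affinity f g a)⁻¹ * (f x ^ a * g x ^ (1 - a))

lemma dKL_nonneg {S : Type*} [Fintype S] {p q : S → ℝ} (hp : ∀ x, 0 ≤ p x)
    (hq : ∀ x, 0 < q x) (hpq : ∑ x, q x ≤ ∑ x, p x) : 0 ≤ dKL p q := by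
  have hpoint : ∀ x, p x - q x ≤ p x * Real.log (p x / q x) := by
    intro x
    rcases (hp x).eq_or_lt with h | h
    · simp [← h, (hq x).le]
    · have hlog := Real.log_le_sub_one_of_pos (div_pos (hq x) h)
      rw [← inv_div, Real.log_inv]
      have hmul := mul_le_mul_of_nonneg_left hlog h.le
      have hcancel : p x * (q x / p x - 1) = q x - p x := by field_simp
      linarith
  calc 0 ≤ ∑ x, (p x - q x) := by rw [sum_sub_distrib]; linarith
    _ ≤ dKL p q := sum_le_sum fun x _ => hpoint x

lemma dKL_self {S : Type*} [Fintype S] {p : S → ℝ} (hp : ∀ x, 0 < p x) : dKL p p = 0 :=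
  sum_eq_zero fun x _ => by rw [div_self (hp x).ne', Real.log_one, mul_zero]

section

variable {S : Type*} [Fintype S] {f g : S → ℝ}

lemma affinity_pos [Nonempty S] (hf : ∀ x, 0 < f x) (hg : ∀ x, 0 < g x) (a : ℝ) :
    0 < affinity f g a :=
  sum_pos (fun x _ => mul_pos (Real.rpow_pos_of_pos (hf x) _) (Real.rpow_pos_of_pos (hg x) _))
    univ_nonempty

lemma geomMixture_pos [Nonempty S] (hf : ∀ x, 0 < f x) (hg : ∀ x, 0 < g x) (a : ℝ) (x : S) :
    0 < geomMixture f g a x :=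
  mul_pos (inv_pos.2 (affinity_pos hf hg a))
    (mul_pos (Real.rpow_pos_of_pos (hf x) _) (Real.rpow_pos_of_pos (hg x) _))

lemma sum_geomMixture [Nonempty S] (hf : ∀ x, 0 < f x) (hg : ∀ x, 0 < g x) (a : ℝ) :
    ∑ x, geomMixture f g a x = 1 := by
  simp only [geomMixture]
  rw [← mul_sum]
  exact inv_mul_cancel₀ (affinity_pos hf hg a).ne'

/-- A convex combination of divergences to `f` and `g` is, up to a constant, the divergence to
their geometric mixture. -/
lemma mul_dKL_add_mul_dKL [Nonempty S] (hf : ∀ x, 0 < f x) (hg : ∀ x, 0 < g x) (a : ℝ)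
    {p : S → ℝ} (hp : ∀ x, 0 ≤ p x) (hp1 : ∑ x, p x = 1) :
    a * dKL p f + (1 - a) * dKL p g
      = dKL p (geomMixture f g a) - Real.log (affinity f g a) := by
  have hZ := affinity_pos hf hg a
  have hlog : Real.log (affinity f g a) = ∑ x, p x * Real.log (affinity f g a) := by
    rw [← sum_mul, hp1, one_mul]
  rw [hlog]
  simp only [dKL]
  rw [mul_sum, mul_sum, ← sum_add_distrib, ← sum_sub_distrib]
  refine sum_congr rfl fun x _ => ?_
  rcases (hp x).eq_or_lt with h | h
  · simp [← h]
  · have hfa := Real.rpow_pos_of_pos (hf x) a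
    have hga := Real.rpow_pos_of_pos (hg x) (1 - a)
    rw [Real.log_div h.ne' (hf x).ne', Real.log_div h.ne' (hg x).ne',
      Real.log_div h.ne' (geomMixture_pos hf hg a x).ne', geomMixture,
      Real.log_mul (inv_pos.2 hZ).ne' (mul_pos hfa hga).ne', Real.log_mul hfa.ne' hga.ne',
      Real.log_inv, Real.log_rpow (hf x), Real.log_rpow (hg x)]
    ring

lemma mul_renyiDiv_one_sub {a : ℝ} (ha : a ≠ 0) :
    a * renyiDiv (1 - a) g f = -Real.log (affinity f g a) := by
  have hsum : ∑ x, g x ^ (1 - a) * f x ^ (1 - (1 - a)) = affinity f g a :=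
    sum_congr rfl fun x _ => by rw [sub_sub_cancel, mul_comm]
  rw [renyiDiv, hsum, sub_sub_cancel_left, inv_neg, neg_mul, mul_neg, mul_inv_cancel_left₀ ha]

lemma I1fun_eq_sum {K : ℕ} (α : Fin K → ℝ) (𝒦 : Finset (Fin K)) (h𝒦 : ∑ j ∈ 𝒦, α j ≠ 0)
    (p : Fin K → S → ℝ) :
    I1fun α f g 𝒦 p = ∑ l, α l * if l ∈ 𝒦 then
      (α l / ∑ j ∈ 𝒦, α j) * dKL (p l) f + (1 - α l / ∑ j ∈ 𝒦, α j) * dKL (p l) g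
      else dKL (p l) g := by
  rw [I1fun, sum_comm]
  refine sum_congr rfl fun l _ => ?_
  have hsum : ∑ k ∈ 𝒦, α k / ∑ j ∈ 𝒦, α j = 1 := by rw [← sum_div, div_self h𝒦]
  have hterm : ∀ k ∈ 𝒦, (α k / ∑ j ∈ 𝒦, α j) * α l * dKL (p l) (if k = l then f else g)
      = (α k / ∑ j ∈ 𝒦, α j) * (α l * dKL (p l) g)
        + if k = l then (α k / ∑ j ∈ 𝒦, α j) * α l * (dKL (p l) f - dKL (p l) g) else 0 := by
    intro k _
    split_ifs <;> ring
  rw [sum_congr rfl hterm, sum_add_distrib, ← sum_mul, hsum, sum_ite_eq']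
  split_ifs <;> ring

lemma sum_renyiDiv_eq {K : ℕ} (α : Fin K → ℝ) (𝒦 : Finset (Fin K))
    (h𝒦 : ∀ k ∈ 𝒦, 0 < α k) :
    ∑ k ∈ 𝒦, (α k / ∑ j ∈ 𝒦, α j) * α k * renyiDiv (1 - α k / ∑ j ∈ 𝒦, α j) g f
      = ∑ l, α l * if l ∈ 𝒦 then -Real.log (affinity f g (α l / ∑ j ∈ 𝒦, α j)) else 0 := by
  simp only [mul_ite, mul_zero]
  rw [sum_ite_mem, univ_inter]
  refine sum_congr rfl fun k hk => ?_
  have ha : α k / ∑ j ∈ 𝒦, α j ≠ 0 := (div_pos (h𝒦 k hk) (sum_pos h𝒦 ⟨k, hk⟩)).ne'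
  rw [← mul_renyiDiv_one_sub ha]
  ring

lemma sum_renyiDiv_le_I1fun [Nonempty S] (hf : ∀ x, 0 < f x) (hg : ∀ x, 0 < g x)
    (hg1 : ∑ x, g x = 1) {K : ℕ} {α : Fin K → ℝ} (hα : ∀ k, 0 ≤ α k) {𝒦 : Finset (Fin K)}
    (hne : 𝒦.Nonempty) (h𝒦 : ∀ k ∈ 𝒦, 0 < α k) {p : Fin K → S → ℝ} (hp : ∀ l x, 0 ≤ p l x)
    (hp1 : ∀ l, ∑ x, p l x = 1) :
    ∑ k ∈ 𝒦, (α k / ∑ j ∈ 𝒦, α j) * α k * renyiDiv (1 - α k / ∑ j ∈ 𝒦, α j) g f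
      ≤ I1fun α f g 𝒦 p := by
  rw [sum_renyiDiv_eq α 𝒦 h𝒦, I1fun_eq_sum α 𝒦 (sum_pos h𝒦 hne).ne']
  refine sum_le_sum fun l _ => mul_le_mul_of_nonneg_left ?_ (hα l)
  split_ifs
  · rw [mul_dKL_add_mul_dKL hf hg _ (hp l) (hp1 l)]
    have := dKL_nonneg (hp l) (geomMixture_pos hf hg (α l / ∑ j ∈ 𝒦, α j))
      (by rw [sum_geomMixture hf hg, hp1])
    linarith
  · exact dKL_nonneg (hp l) hg (by rw [hg1, hp1])

lemma I1fun_geomMixture [Nonempty S] (hf : ∀ x, 0 < f x) (hg : ∀ x, 0 < g x)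
    {K : ℕ} {α : Fin K → ℝ} {𝒦 : Finset (Fin K)} (hne : 𝒦.Nonempty) (h𝒦 : ∀ k ∈ 𝒦, 0 < α k) :
    I1fun α f g 𝒦 (fun k => if k ∈ 𝒦 then geomMixture f g (α k / ∑ j ∈ 𝒦, α j) else g)
      = ∑ k ∈ 𝒦, (α k / ∑ j ∈ 𝒦, α j) * α k * renyiDiv (1 - α k / ∑ j ∈ 𝒦, α j) g f := by
  rw [sum_renyiDiv_eq α 𝒦 h𝒦, I1fun_eq_sum α 𝒦 (sum_pos h𝒦 hne).ne']
  refine sum_congr rfl fun l _ => ?_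
  split_ifs
  · rw [mul_dKL_add_mul_dKL hf hg _ (fun x => (geomMixture_pos hf hg _ x).le)
      (sum_geomMixture hf hg _), dKL_self (geomMixture_pos hf hg _), zero_sub]
  · rw [dKL_self hg]

lemma sum_renyiDiv_of_const {K : ℕ} {α : Fin K → ℝ} {c : ℝ} (hc : 0 < c) (hα : ∀ k, α k = c)
    {𝒦 : Finset (Fin K)} (hne : 𝒦.Nonempty) :
    ∑ k ∈ 𝒦, (α k / ∑ j ∈ 𝒦, α j) * α k * renyiDiv (1 - α k / ∑ j ∈ 𝒦, α j) g f
      = c * (𝒦.card * -Real.log (affinity f g (𝒦.card : ℝ)⁻¹)) := by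
  have hcard : (𝒦.card : ℝ) ≠ 0 := by exact_mod_cast hne.card_pos.ne'
  have hdiv : c / (𝒦.card * c) = (𝒦.card : ℝ)⁻¹ := by field_simp
  simp only [hα, sum_const, nsmul_eq_mul, hdiv]
  rw [← mul_renyiDiv_one_sub (inv_ne_zero hcard)]
  ring

/-- Monotonicity of the Rényi divergence in its order, in terms of affinities. -/
lemma affinity_rpow_le (hf : ∀ x, 0 < f x) (hg : ∀ x, 0 < g x)
    (hg1 : ∑ x, g x = 1) (a : ℝ) {r : ℝ} (hr : 1 ≤ r) :
    affinity f g a ^ r ≤ affinity f g (a * r) := by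
  have hweight : ∀ b, affinity f g b = ∑ x, g x * (f x / g x) ^ b := by
    intro b
    refine sum_congr rfl fun x _ => ?_
    rw [Real.div_rpow (hf x).le (hg x).le, Real.rpow_sub (hg x), Real.rpow_one]
    ring
  have hmean := Real.rpow_arith_mean_le_arith_mean_rpow univ g (fun x => (f x / g x) ^ a)
    (fun x _ => (hg x).le) hg1
    (fun x _ => Real.rpow_nonneg (div_pos (hf x) (hg x)).le _) hr
  rw [hweight, hweight]
  refine hmean.trans_eq (sum_congr rfl fun x _ => ?_)
  rw [← Real.rpow_mul (div_pos (hf x) (hg x)).le]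

lemma renyiDiv_half_eq : renyiDiv (1 / 2) f g = 2 * -Real.log (affinity f g 2⁻¹) := by
  rw [renyiDiv, affinity]
  norm_num

lemma renyiDiv_half_le [Nonempty S] (hf : ∀ x, 0 < f x) (hg : ∀ x, 0 < g x)
    (hg1 : ∑ x, g x = 1) {n : ℝ} (hn : 2 ≤ n) :
    renyiDiv (1 / 2) f g ≤ n * -Real.log (affinity f g n⁻¹) := by
  have hZ := affinity_pos hf hg n⁻¹
  have hle := affinity_rpow_le hf hg hg1 n⁻¹ (r := n / 2) (by linarith)
  have hexp : n⁻¹ * (n / 2) = 2⁻¹ := by field_simp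
  rw [hexp] at hle
  have hlog := Real.log_le_log (Real.rpow_pos_of_pos hZ _) hle
  rw [Real.log_rpow hZ] at hlog
  rw [renyiDiv_half_eq]
  linarith

end

/-- Minimisation of the expected log-likelihood-ratio functional `I₁` over the reference
distributions, and its value for uniform `α`. -/
theorem minimum_I1
    (K : ℕ) (hK : 2 ≤ K) (S : Type*) [Fintype S]
    (f g : S → ℝ) (hfpos : ∀ x, 0 < f x) (hgpos : ∀ x, 0 < g x)
    (hf1 : ∑ x, f x = 1) (hg1 : ∑ x, g x = 1)
    (α : Fin K → ℝ) (hα0 : ∀ k, 0 ≤ α k) (hα1 : ∑ k, α k = 1)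
    (𝒦 : Finset (Fin K)) (h𝒦card : 2 ≤ 𝒦.card) (h𝒦pos : ∀ k ∈ 𝒦, 0 < α k)
    (αstar : Fin K → ℝ) (hαstar : ∀ k, αstar k = α k / ∑ j ∈ 𝒦, α j)
    (fstaropt : Fin K → S → ℝ)
    (hfsopt : ∀ k, fstaropt k = if k ∈ 𝒦 then
        (fun x => (∑ y, f y ^ αstar k * g y ^ (1 - αstar k))⁻¹ *
          (f x ^ αstar k * g x ^ (1 - αstar k)))
      else g) :
    -- (a) the minimum of `I₁` over probability mass functions equals
    --     `∑_{k∈𝒦} α*_k α_k D_{1−α*_k}(g‖f)`, and it is attained at `fstaropt`: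
    (∀ fstar : Fin K → S → ℝ, (∀ l x, 0 ≤ fstar l x) → (∀ l, ∑ x, fstar l x = 1) →
        (∑ k ∈ 𝒦, αstar k * α k * renyiDiv (1 - αstar k) g f) ≤ I1fun α f g 𝒦 fstar) ∧
    I1fun α f g 𝒦 fstaropt = ∑ k ∈ 𝒦, αstar k * α k * renyiDiv (1 - αstar k) g f ∧
    -- (b) for uniform `α`, the minimum over all `𝒦` with `|𝒦| ≥ 2` and all `f*`
    --     equals `K⁻¹ D_{1/2}(f‖g)`:
    ((∀ k, α k = (K : ℝ)⁻¹) →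
      ((∀ 𝒦' : Finset (Fin K), 2 ≤ 𝒦'.card →
          ∀ fstar : Fin K → S → ℝ, (∀ l x, 0 ≤ fstar l x) → (∀ l, ∑ x, fstar l x = 1) →
          (K : ℝ)⁻¹ * renyiDiv (1 / 2) f g ≤ I1fun α f g 𝒦' fstar) ∧
       (∃ 𝒦' : Finset (Fin K), 2 ≤ 𝒦'.card ∧
          ∃ fstar : Fin K → S → ℝ, (∀ l x, 0 ≤ fstar l x) ∧ (∀ l, ∑ x, fstar l x = 1) ∧
            I1fun α f g 𝒦' fstar = (K : ℝ)⁻¹ * renyiDiv (1 / 2) f g))) := by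
  have hS : Nonempty S := by
    by_contra h
    rw [not_nonempty_iff] at h
    simp at hf1
  have hne : 𝒦.Nonempty := card_pos.1 (by omega)
  obtain rfl : αstar = fun k => α k / ∑ j ∈ 𝒦, α j := funext hαstar
  obtain rfl : fstaropt =
      fun k => if k ∈ 𝒦 then geomMixture f g (α k / ∑ j ∈ 𝒦, α j) else g := funext hfsopt
  refine ⟨fun p hp hp1 => sum_renyiDiv_le_I1fun hfpos hgpos hg1 hα0 hne h𝒦pos hp hp1,
    I1fun_geomMixture hfpos hgpos hne h𝒦pos, fun hunif => ?_⟩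
  have hKinv : (0 : ℝ) < (K : ℝ)⁻¹ := by
    have : 0 < K := by omega
    positivity
  have hαpos : ∀ k, 0 < α k := fun k => by rw [hunif]; exact hKinv
  constructor
  · intro 𝒦' hcard p hp hp1
    have hne' : 𝒦'.Nonempty := card_pos.1 (by omega)
    refine le_trans ?_
      (sum_renyiDiv_le_I1fun hfpos hgpos hg1 hα0 hne' (fun k _ => hαpos k) hp hp1)
    rw [sum_renyiDiv_of_const hKinv hunif hne']
    exact mul_le_mul_of_nonneg_left
      (renyiDiv_half_le hfpos hgpos hg1 (by exact_mod_cast hcard)) hKinv.le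
  · obtain ⟨𝒦', -, hcard⟩ := exists_subset_card_eq (s := (univ : Finset (Fin K))) (n := 2)
      (by simpa using hK)
    have hne' : 𝒦'.Nonempty := card_pos.1 (by omega)
    refine ⟨𝒦', hcard.ge,
      fun k => if k ∈ 𝒦' then geomMixture f g (α k / ∑ j ∈ 𝒦', α j) else g,
      fun l x => ?_, fun l => ?_, ?_⟩
    · dsimp only
      split_ifs
      exacts [(geomMixture_pos hfpos hgpos _ x).le, (hgpos x).le]
    · dsimp only
      split_ifs
      exacts [sum_geomMixture hfpos hgpos _, hg1]
    · rw [I1fun_geomMixture hfpos hgpos hne' fun k _ => hαpos k,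
        sum_renyiDiv_of_const hKinv hunif hne', hcard, renyiDiv_half_eq, Nat.cast_ofNat]
end
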